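/- If ρ < m, then s_{q^m/q}(k+1, ρ+1) ≤ s_{q^m/q}(k, ρ) + 1, where s_{q^m/q}(k,ρ) denotes the minimal F_q-dimension of a rank-ρ-saturating system in F_{q^m}^k. -/

import Mathlib

/-- `U` covers with radius `r`: every vector of `F_{q^m}^k` lies in the `F_{q^m}`-span
of an `F_q`-subspace of `U` of `F_q`-dimension at most `r`. -/
def RkCovers (K : Type*) {L : Type*} [Field K] [Field L] [Algebra K L]
    {ι : Type*} (U : Submodule K (ι → L)) (r : ℕ) : Prop :=
  ∀ v : ι → L, ∃ S : Submodule K (ι → L), S ≤ U ∧ Module.finrank K S ≤ r ∧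
    v ∈ Submodule.span L (S : Set (ι → L))

/-- `U` is rank-`ρ`-saturating: it covers with radius `ρ` and `ρ` is minimal. -/
def IsRankSat (K : Type*) {L : Type*} [Field K] [Field L] [Algebra K L]
    {ι : Type*} (U : Submodule K (ι → L)) (ρ : ℕ) : Prop :=
  RkCovers K U ρ ∧ ∀ r < ρ, ¬ RkCovers K U r

/-- `s_{q^m/q}(k, ρ)`: the minimal `F_q`-dimension of a rank-`ρ`-saturating
`[n,k]_{q^m/q}` system in `F_{q^m}^k`. -/
noncomputable def sMin (K L : Type*) [Field K] [Field L] [Algebra K L] (k ρ : ℕ) : ℕ :=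
  sInf {n : ℕ | ∃ U : Submodule K (Fin k → L),
    Module.finrank K U = n ∧ Submodule.span L (U : Set (Fin k → L)) = ⊤ ∧
      IsRankSat K U ρ}

section helpers
set_option linter.unusedSectionVars false
variable {K L : Type*} [Field K] [Field L] [Algebra K L] [Fintype K] [Fintype L]

lemma RkCovers.mono' {ι : Type*} {U : Submodule K (ι → L)} {r s : ℕ}
    (h : RkCovers K U r) (hrs : r ≤ s) : RkCovers K U s := fun v => by
  obtain ⟨S, h1, h2, h3⟩ := h v
  exact ⟨S, h1, h2.trans hrs, h3⟩

lemma finrank_sup_singleton_le {E : Type*} [AddCommGroup E] [Module K E] [Module.Finite K E]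
    (S : Submodule K E) (b : E) :
    Module.finrank K (S ⊔ Submodule.span K {b} : Submodule K E) ≤ Module.finrank K S + 1 := by
  have h1 := Submodule.finrank_add_le_finrank_add_finrank S (Submodule.span K {b})
  have h2 : Module.finrank K (Submodule.span K {b}) ≤ 1 := by
    have := finrank_span_le_card (R := K) ({b} : Set E)
    simpa using this
  omega

lemma RkCovers.step {n : ℕ} {V W : Submodule K (Fin n → L)} {b : Fin n → L} (hb : b ∈ W)
    (h : ∀ x ∈ V, ∃ y ∈ W, ∃ c : L, x = y + c • b) {r : ℕ} (hV : RkCovers K V r) :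
    RkCovers K W (r + 1) := by
  intro v
  obtain ⟨S, hS, hr, hv⟩ := hV v
  let B := Module.finBasis K S
  have h' : ∀ i, ∃ y ∈ W, ∃ c : L, (B i : Fin n → L) = y + c • b :=
    fun i => h _ (hS (B i).2)
  choose y hyW c hc using h'
  refine ⟨Submodule.span K (Set.range y) ⊔ Submodule.span K {b}, ?_, ?_, ?_⟩
  · refine sup_le (Submodule.span_le.2 ?_) (Submodule.span_le.2 (by simpa using hb))
    rintro _ ⟨i, rfl⟩
    exact hyW i
  · refine (finrank_sup_singleton_le _ _).trans ?_
    have := finrank_range_le_card (R := K) y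
    rw [Fintype.card_fin] at this
    have h2 : Module.finrank K (Submodule.span K (Set.range y)) ≤ Module.finrank K S := this
    omega
  · set T := Submodule.span K (Set.range y) ⊔ Submodule.span K {b} with hT
    have hle : S ≤ (Submodule.span L (T : Set (Fin n → L))).restrictScalars K := by
      intro x hx
      have hx' := B.sum_repr ⟨x, hx⟩
      have hx2 : x = ∑ i, (B.repr ⟨x, hx⟩ i) • (B i : Fin n → L) := by
        have := congrArg (Subtype.val) hx'
        simpa [-Module.Basis.sum_repr] using this.symm
      rw [hx2]
      refine Submodule.sum_mem _ fun i _ => Submodule.smul_mem _ _ ?_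
      rw [hc i]
      have hyT : y i ∈ T := Submodule.mem_sup_left (Submodule.subset_span ⟨i, rfl⟩)
      have hbT : b ∈ T := Submodule.mem_sup_right (Submodule.mem_span_singleton_self b)
      exact Submodule.add_mem (Submodule.span L (T : Set (Fin n → L))) (Submodule.subset_span hyT)
        (Submodule.smul_mem _ _ (Submodule.subset_span hbT))
    exact (Submodule.span_le.2 (fun x hx => hle hx) :
      Submodule.span L (S : Set (Fin n → L)) ≤ _) hv

lemma not_covers {n r : ℕ} {ι : Type*} [Fintype ι] (b : Module.Basis ι L (Fin n → L))
    (hι : Fintype.card ι = n)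
    (U : Submodule K (Fin n → L)) (hU : ∀ x ∈ U, ∀ i, ∃ c : K, algebraMap K L c = b.repr x i)
    (hn : r < n) (hm : r < Module.finrank K L) : ¬ RkCovers K U r := by
  intro hcov
  obtain ⟨f⟩ : Nonempty (Fin (r+1) ↪ ι) :=
    Function.Embedding.nonempty_of_card_le (by simp [hι]; omega)
  let A := Module.finBasis K L
  let g : Fin (r+1) → Fin (Module.finrank K L) := Fin.castLE hm
  have hg : Function.Injective g := Fin.castLE_injective hm
  have hA : LinearIndependent K (A ∘ g) := A.linearIndependent.comp g hg
  obtain ⟨S, hS, hr, hv⟩ := hcov (∑ i, A (g i) • b (f i))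
  let B := Module.finBasis K S
  have h' : ∀ (l : Fin (Module.finrank K S)) (i : Fin (r+1)),
      ∃ c : K, algebraMap K L c = b.repr (B l : Fin n → L) (f i) :=
    fun l i => hU _ (hS (B l).2) _
  choose M hM using h'
  have hker : LinearMap.ker (Matrix.mulVecLin (Matrix.of M)) ≠ ⊥ :=
    LinearMap.ker_ne_bot_of_finrank_lt (by simp; omega)
  obtain ⟨c, hc, hc0⟩ := (Submodule.ne_bot_iff _).1 hker
  let φ : (Fin n → L) →ₗ[L] L := ∑ i, (algebraMap K L (c i)) • b.coord (f i)
  have hφ : ∀ x, φ x = ∑ i, algebraMap K L (c i) * b.repr x (f i) := by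
    intro x; simp [φ, Algebra.smul_def]
  have hle : S ≤ (LinearMap.ker φ).restrictScalars K := by
    intro x hx
    have hx' := B.sum_repr ⟨x, hx⟩
    have hx2 : x = ∑ i, (B.repr ⟨x, hx⟩ i) • (B i : Fin n → L) := by
      have := congrArg (Subtype.val) hx'
      simpa [-Module.Basis.sum_repr] using this.symm
    rw [hx2]
    refine Submodule.sum_mem _ fun l _ => Submodule.smul_mem _ _ ?_
    change φ _ = 0
    rw [hφ]
    have h0 : (Matrix.mulVecLin (Matrix.of M)) c l = 0 := by
      rw [LinearMap.mem_ker.1 hc]; rfl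
    simp only [Matrix.mulVecLin_apply, Matrix.mulVec, dotProduct, Matrix.of_apply] at h0
    have := congrArg (algebraMap K L) h0
    simp only [map_sum, map_mul, map_zero] at this
    rw [← this]
    exact Finset.sum_congr rfl fun i _ => by rw [hM, mul_comm]
  have hv0 : φ (∑ i, A (g i) • b (f i)) = 0 :=
    (Submodule.span_le.2 (fun x hx => hle hx) :
      Submodule.span L (S : Set (Fin n → L)) ≤ LinearMap.ker φ) hv
  have hval : ∀ i, b.repr (∑ i, A (g i) • b (f i)) (f i) = A (g i) := by
    intro i
    classical
    simp [Finsupp.single_apply, f.injective.eq_iff]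
  rw [hφ] at hv0
  simp only [hval] at hv0
  apply hc0
  funext i
  refine Fintype.linearIndependent_iff.1 hA c ?_ i
  simpa [Algebra.smul_def] using hv0

/-- kill the `j`-th coordinate. -/
noncomputable def killCoord {n : ℕ} {ι : Type*} (b : Module.Basis ι L (Fin n → L)) (j : ι) :
    (Fin n → L) →ₗ[L] (Fin n → L) :=
  LinearMap.id - (b.coord j).smulRight (b j)

lemma killCoord_apply {n : ℕ} {ι : Type*} (b : Module.Basis ι L (Fin n → L)) (j : ι)
    (x : Fin n → L) : killCoord b j x = x - b.repr x j • b j := by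
  simp [killCoord]

lemma key {n r : ℕ} (U : Submodule K (Fin n → L))
    (hspan : Submodule.span L (U : Set (Fin n → L)) = ⊤) (hcov : RkCovers K U (r + 1))
    (hn : r < n) (hm : r < Module.finrank K L) :
    ∃ U' : Submodule K (Fin n → L), Module.finrank K U' ≤ Module.finrank K U ∧
      Submodule.span L (U' : Set (Fin n → L)) = ⊤ ∧ IsRankSat K U' (r + 1) := by
  classical
  by_contra hno
  let b := Module.Basis.ofSpan hspan.ge
  have hbU : ∀ i, b i ∈ U := fun i => Module.Basis.ofSpan_subset hspan.ge ⟨i, rfl⟩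
  generalize hbb : b = b' at hbU
  clear hbb b
  revert b'
  generalize (((linearIndepOn_empty L id).extend (Set.empty_subset (U : Set (Fin n → L))) :
    Set (Fin n → L)) : Type _) = ι
  intro b hbU
  have : Finite ι := Module.Finite.finite_basis b
  have := Fintype.ofFinite ι
  have hcard : Fintype.card ι = n := by
    rw [← Module.finrank_eq_card_basis b]; simp
  have main : ∀ T : Finset ι, ∃ V : Submodule K (Fin n → L),
      Module.finrank K V ≤ Module.finrank K U ∧ (∀ i, b i ∈ V) ∧ RkCovers K V r ∧
      ∀ x ∈ V, ∀ i ∈ T, ∃ c : K, algebraMap K L c = b.repr x i := by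
    have good : ∀ V : Submodule K (Fin n → L), Module.finrank K V ≤ Module.finrank K U →
        (∀ i, b i ∈ V) → RkCovers K V (r + 1) → RkCovers K V r := by
      intro V h1 h2 h3
      by_contra h4
      refine hno ⟨V, h1, ?_, h3, fun s hs h5 => h4 (h5.mono' (by omega))⟩
      rw [eq_top_iff, ← b.span_eq]
      refine Submodule.span_mono ?_
      rintro _ ⟨i, rfl⟩
      exact h2 i
    intro T
    induction T using Finset.induction_on with
    | empty => exact ⟨U, le_rfl, hbU, good U le_rfl hbU hcov, by simp⟩
    | insert j T hj ih =>
      obtain ⟨V, h1, h2, h3, h4⟩ := ih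
      let π : (Fin n → L) →ₗ[K] (Fin n → L) := (killCoord b j).restrictScalars K
      have hπ : ∀ x, π x = x - b.repr x j • b j := fun x => killCoord_apply b j x
      let W := V.map π ⊔ Submodule.span K {b j}
      have hbW : ∀ i, b i ∈ W := by
        intro i
        by_cases hij : i = j
        · subst hij
          exact Submodule.mem_sup_right (Submodule.mem_span_singleton_self _)
        · refine Submodule.mem_sup_left ⟨b i, h2 i, ?_⟩
          rw [hπ]
          simp [hij]
      have hdim : Module.finrank K W ≤ Module.finrank K U := by
        refine (finrank_sup_singleton_le _ _).trans (le_trans ?_ h1)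
        have hrn := LinearMap.finrank_range_add_finrank_ker (π.domRestrict V)
        rw [LinearMap.range_domRestrict] at hrn
        have hpos : 0 < Module.finrank K (LinearMap.ker (π.domRestrict V)) := by
          have hmem : (⟨b j, h2 j⟩ : V) ∈ LinearMap.ker (π.domRestrict V) := by
            rw [LinearMap.mem_ker, LinearMap.domRestrict_apply, hπ]
            simp
          rw [Nat.pos_iff_ne_zero, Ne, Submodule.finrank_eq_zero]
          intro h0
          rw [h0, Submodule.mem_bot] at hmem
          exact b.ne_zero j (congrArg Subtype.val hmem)
        omega
      refine ⟨W, hdim, hbW, good W hdim hbW ?_, ?_⟩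
      · refine RkCovers.step (hbW j) ?_ h3
        intro x hx
        refine ⟨π x, Submodule.mem_sup_left ⟨x, hx, rfl⟩, b.repr x j, ?_⟩
        rw [hπ]; simp
      · intro x hx i hi
        obtain ⟨_, ⟨y, hy, rfl⟩, z, hz, rfl⟩ := Submodule.mem_sup.1 hx
        obtain ⟨a, rfl⟩ := Submodule.mem_span_singleton.1 hz
        rw [← algebraMap_smul L a (b j), hπ]
        by_cases hij : i = j
        · subst hij
          exact ⟨a, by rw [map_add, map_smul]; simp [Algebra.algebraMap_eq_smul_one]⟩
        · obtain ⟨c, hc⟩ := h4 y hy i (Finset.mem_of_mem_insert_of_ne hi hij)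
          refine ⟨c, ?_⟩
          simp only [map_add, map_sub, map_smul, Module.Basis.repr_self, Finsupp.add_apply,
            Finsupp.sub_apply, Finsupp.smul_apply, Finsupp.single_apply, if_neg (Ne.symm hij), hc]
          simp
  obtain ⟨V, -, -, h3, h4⟩ := main Finset.univ
  exact not_covers b hcard V (fun x hx i => h4 x hx i (Finset.mem_univ i)) hn hm h3

/-- prepend a zero. -/
def consZero (L : Type*) [Field L] (k : ℕ) : (Fin k → L) →ₗ[L] (Fin (k+1) → L) where
  toFun x := Fin.cons 0 x
  map_add' x y := by
    funext i; refine Fin.cases ?_ (fun i => ?_) i <;> simp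
  map_smul' a x := by
    funext i; refine Fin.cases ?_ (fun i => ?_) i <;> simp

lemma cons_decomp {k : ℕ} (v : Fin (k+1) → L) :
    v = consZero L k (Fin.tail v) + v 0 • (Fin.cons 1 0 : Fin (k+1) → L) := by
  funext i; refine Fin.cases ?_ (fun i => ?_) i <;> simp [consZero, Fin.tail]

lemma mem_span_ext {k : ℕ} (S : Submodule K (Fin k → L)) (v : Fin (k+1) → L)
    (hv : Fin.tail v ∈ Submodule.span L (S : Set (Fin k → L))) :
    v ∈ Submodule.span L ((S.map ((consZero L k).restrictScalars K) ⊔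
      Submodule.span K {(Fin.cons 1 0 : Fin (k+1) → L)} : Submodule K (Fin (k+1) → L)) :
        Set (Fin (k+1) → L)) := by
  rw [cons_decomp v]
  refine Submodule.add_mem _ ?_ (Submodule.smul_mem _ _ (Submodule.subset_span
    (Submodule.mem_sup_right (Submodule.mem_span_singleton_self _))))
  have h : Submodule.span L (S : Set (Fin k → L)) ≤ (Submodule.span L
      ((S.map ((consZero L k).restrictScalars K) ⊔
      Submodule.span K {(Fin.cons 1 0 : Fin (k+1) → L)} : Submodule K (Fin (k+1) → L)) :
        Set (Fin (k+1) → L))).comap (consZero L k) := by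
    refine Submodule.span_le.2 fun x hx => ?_
    exact Submodule.subset_span (Submodule.mem_sup_left ⟨x, hx, rfl⟩)
  exact h hv

end helpers

/-- If `ρ < m`, then `s_{q^m/q}(k+1, ρ+1) ≤ s_{q^m/q}(k, ρ) + 1`. -/
theorem sMin_succ_succ (K L : Type*) [Field K] [Field L] [Algebra K L]
    [Fintype K] [Fintype L] {k ρ : ℕ}
    (hρ : 1 ≤ ρ) (hρk : ρ ≤ k) (hρm : ρ < Module.finrank K L) :
    sMin K L (k + 1) (ρ + 1) ≤ sMin K L k ρ + 1 := by
  have hne : {n : ℕ | ∃ U : Submodule K (Fin k → L),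
    Module.finrank K U = n ∧ Submodule.span L (U : Set (Fin k → L)) = ⊤ ∧
      IsRankSat K U ρ}.Nonempty := by
    obtain ⟨r, rfl⟩ : ∃ r, ρ = r + 1 := ⟨ρ - 1, by omega⟩
    obtain ⟨U, -, h2, h3⟩ := key (K := K) (L := L) (n := k) (r := r) ⊤ (by simp) (by
      intro v
      refine ⟨Submodule.span K {v}, le_top, ?_, Submodule.subset_span
        (Submodule.mem_span_singleton_self v)⟩
      have := finrank_span_le_card (R := K) ({v} : Set (Fin k → L))
      have h1 : Module.finrank K (Submodule.span K {v}) ≤ 1 := by simpa using this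
      omega) (by omega) (by omega)
    exact ⟨_, U, rfl, h2, h3⟩
  obtain ⟨U, hU1, hU2, hU3, -⟩ := Nat.sInf_mem hne
  change Module.finrank K U = sMin K L k ρ at hU1
  let W := U.map ((consZero L k).restrictScalars K) ⊔
    Submodule.span K {(Fin.cons 1 0 : Fin (k+1) → L)}
  have hmap : ∀ S : Submodule K (Fin k → L),
      Module.finrank K (S.map ((consZero L k).restrictScalars K) ⊔
        Submodule.span K {(Fin.cons 1 0 : Fin (k+1) → L)} : Submodule K (Fin (k+1) → L)) ≤
        Module.finrank K S + 1 := fun S =>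
    (finrank_sup_singleton_le _ _).trans
      (Nat.add_le_add_right (Submodule.finrank_map_le _ _) 1)
  obtain ⟨V, h1, h2, h3⟩ := key (K := K) (L := L) (n := k + 1) (r := ρ) W
    (by
      rw [eq_top_iff]
      intro v _
      exact mem_span_ext U v (by rw [hU2]; trivial))
    (by
      intro v
      obtain ⟨S, hS, hr, hv⟩ := hU3 (Fin.tail v)
      exact ⟨_, sup_le_sup_right (Submodule.map_mono hS) _,
        (hmap S).trans (Nat.add_le_add_right hr 1), mem_span_ext S v hv⟩)
    (by omega) hρm
  have hle : sMin K L (k + 1) (ρ + 1) ≤ Module.finrank K V := Nat.sInf_le ⟨V, rfl, h2, h3⟩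
  have := hmap U
  have h4 : Module.finrank K W ≤ Module.finrank K U + 1 := this
  omega
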